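/- arXiv:2010.15860 — 2 statements merged into one kernel-verified Lean document; each statement's English description precedes it below -/
import Mathlib

section
/- Let (X,d) be a metric space, α > 0, and A ⊆ X a nonempty bounded Borel set. Then the capacity of A with respect to the kernel N(x,y) = d(x,y)^{−α} (with N(x,x) = +∞) is bounded by the α-dimensional Hausdorff measure of A: Cap_N(A) ≤ H^α(A). Equivalently, every Borel probability measure ν with ν(A) = 1 satisfies ∬_{A×A} d(x,y)^{−α} dν(x) dν(y) · H^α(A) ≥ 1. -/
open MeasureTheory ENNReal

/-- The capacity of a set `A` with respect to a kernel `K`: the reciprocal of the infimum of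
the energies `∬_{A×A} K dν dν` over Borel probability measures `ν` with `ν(A) = 1`.
(If no such measure exists the infimum is `∞` and the capacity is `0`; `1/0 = ∞`.) -/
noncomputable def capacity {X : Type*} [MeasurableSpace X] (K : X → X → ℝ≥0∞) (A : Set X) :
    ℝ≥0∞ :=
  (⨅ (ν : Measure X) (_ : IsProbabilityMeasure ν) (_ : ν A = 1),
    ∫⁻ x in A, ∫⁻ y in A, K x y ∂ν ∂ν)⁻¹

/-- The Cauchy–Schwarz inequality for series in `ℝ≥0∞`. -/
lemma ENNReal.sq_tsum_mul_le {ι : Type*} (a b : ι → ℝ≥0∞) :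
    (∑' i, a i * b i) ^ 2 ≤ (∑' i, a i ^ 2) * ∑' i, b i ^ 2 := by
  let _ : MeasurableSpace ι := ⊤
  have h := ENNReal.lintegral_mul_le_Lp_mul_Lq (Measure.count : Measure ι)
    Real.HolderConjugate.two_two (f := a) (g := b)
    measurable_from_top.aemeasurable measurable_from_top.aemeasurable
  simp only [lintegral_count, Pi.mul_apply, ENNReal.rpow_two] at h
  calc (∑' i, a i * b i) ^ 2
      ≤ ((∑' i, a i ^ 2) ^ (1 / 2 : ℝ) * (∑' i, b i ^ 2) ^ (1 / 2 : ℝ)) ^ 2 := by gcongr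
    _ = (∑' i, a i ^ 2) * ∑' i, b i ^ 2 := by
      rw [mul_pow, ← ENNReal.rpow_two, ← ENNReal.rpow_two, ← ENNReal.rpow_mul,
        ← ENNReal.rpow_mul]
      norm_num

/-- The energy of a measure on a set of small diameter is bounded below. -/
lemma mul_measure_sq_le_lintegral_edist_rpow_neg {X : Type*} [PseudoEMetricSpace X]
    [MeasurableSpace X] (ν : Measure X) {α : ℝ} (hα : 0 ≤ α) {B A : Set X}
    (hB : MeasurableSet B) (hBA : B ⊆ A) {r : ℝ≥0∞} (hr : Metric.ediam B ≤ r) :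
    r ^ (-α) * ν B ^ 2 ≤ ∫⁻ x in B, ∫⁻ y in A, edist x y ^ (-α) ∂ν ∂ν :=
  calc r ^ (-α) * ν B ^ 2 = ∫⁻ _ in B, ∫⁻ _ in B, r ^ (-α) ∂ν ∂ν := by
        simp only [setLIntegral_const]; ring
    _ ≤ ∫⁻ x in B, ∫⁻ y in A, edist x y ^ (-α) ∂ν ∂ν := by
        refine setLIntegral_mono' hB fun x hx => ?_
        refine le_trans (setLIntegral_mono' hB fun y hy => ?_) (lintegral_mono_set hBA)
        rw [ENNReal.rpow_neg, ENNReal.rpow_neg]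
        gcongr
        exact (Metric.edist_le_ediam_of_mem hx hy).trans hr

/-- If countably many sets of finite diameter cover `A`, then the squared mass of `A` is at most
the energy of `ν` on `A` times the sum of the `α`-th powers of the diameters. -/
lemma measure_sq_le_lintegral_edist_rpow_neg_mul_tsum {X : Type*} [PseudoEMetricSpace X]
    [MeasurableSpace X] [OpensMeasurableSpace X] (ν : Measure X) {α : ℝ} (hα : 0 < α) {A : Set X}
    (hA : MeasurableSet A) (hE : ∫⁻ x in A, ∫⁻ y in A, edist x y ^ (-α) ∂ν ∂ν ≠ ∞)
    {t : ℕ → Set X} (hcov : A ⊆ ⋃ n, t n) (hfin : ∀ n, Metric.ediam (t n) ≠ ∞) :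
    ν A ^ 2 ≤ (∫⁻ x in A, ∫⁻ y in A, edist x y ^ (-α) ∂ν ∂ν) *
      ∑' n, Metric.ediam (t n) ^ α := by
  set d : ℕ → ℝ≥0∞ := fun n => Metric.ediam (t n)
  set B : ℕ → Set X := disjointed fun n => closure (t n) ∩ A
  have hBm : ∀ n, MeasurableSet (B n) :=
    fun n => MeasurableSet.disjointed (fun n => measurableSet_closure.inter hA) n
  have hBsub : ∀ n, B n ⊆ closure (t n) ∩ A := fun n => disjointed_subset _ n
  have hBdisj : Pairwise (Function.onFun Disjoint B) := disjoint_disjointed _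
  have hBU : ⋃ n, B n = A := by
    rw [iUnion_disjointed, ← Set.iUnion_inter, Set.inter_eq_right]
    exact hcov.trans (Set.iUnion_mono fun n => subset_closure)
  have hBd : ∀ n, Metric.ediam (B n) ≤ d n := fun n =>
    (Metric.ediam_mono ((hBsub n).trans Set.inter_subset_left)).trans_eq (Metric.ediam_closure _)
  have hterm : ∀ n, d n ^ (-α) * ν (B n) ^ 2 ≤
      ∫⁻ x in B n, ∫⁻ y in A, edist x y ^ (-α) ∂ν ∂ν := fun n =>
    mul_measure_sq_le_lintegral_edist_rpow_neg ν hα.le (hBm n)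
      ((hBsub n).trans Set.inter_subset_right) (hBd n)
  have hsum : ∑' n, d n ^ (-α) * ν (B n) ^ 2 ≤
      ∫⁻ x in A, ∫⁻ y in A, edist x y ^ (-α) ∂ν ∂ν :=
    (ENNReal.tsum_le_tsum hterm).trans_eq (by rw [← lintegral_iUnion hBm hBdisj, hBU])
  have hfactor : ∀ n, ν (B n) = d n ^ (-α / 2) * ν (B n) * d n ^ (α / 2) := by
    intro n
    rcases eq_or_ne (d n) 0 with h0 | h0
    · have hlt := ((ENNReal.le_tsum n).trans hsum).trans_lt hE.lt_top
      have : ν (B n) = 0 := by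
        by_contra hne
        rw [h0, ENNReal.zero_rpow_of_neg (neg_lt_zero.2 hα),
          ENNReal.top_mul (pow_ne_zero 2 hne)] at hlt
        exact hlt.ne rfl
      simp [this]
    · rw [mul_right_comm, ← ENNReal.rpow_add _ _ h0 (hfin n), neg_div, neg_add_cancel,
        ENNReal.rpow_zero, one_mul]
  calc ν A ^ 2 = (∑' n, d n ^ (-α / 2) * ν (B n) * d n ^ (α / 2)) ^ 2 := by
        rw [← tsum_congr hfactor, ← measure_iUnion hBdisj hBm, hBU]
    _ ≤ (∑' n, (d n ^ (-α / 2) * ν (B n)) ^ 2) * ∑' n, (d n ^ (α / 2)) ^ 2 :=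
        ENNReal.sq_tsum_mul_le _ _
    _ = (∑' n, d n ^ (-α) * ν (B n) ^ 2) * ∑' n, d n ^ α := by
        have hsq : ∀ (r : ℝ≥0∞) (s : ℝ), (r ^ (s / 2)) ^ 2 = r ^ s := fun r s => by
          rw [← ENNReal.rpow_two, ← ENNReal.rpow_mul, div_mul_cancel₀ s two_ne_zero]
        simp only [mul_pow, hsq]
    _ ≤ _ := by gcongr

/-- For a nonempty bounded Borel set `A` in a metric space and `α > 0`,
the capacity of `A` with respect to the kernel `N(x,y) = d(x,y)^{-α}` (with `N(x,x) = ∞`)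
is bounded by the `α`-dimensional Hausdorff measure: `Cap_N(A) ≤ H^α(A)`. -/
theorem capacity_le_hausdorffMeasure
    {X : Type*} [MetricSpace X] [MeasurableSpace X] [BorelSpace X]
    (α : ℝ) (hα : 0 < α) (A : Set X) (hne : A.Nonempty) (hbdd : Bornology.IsBounded A)
    (hA : MeasurableSet A) :
    capacity (fun x y => edist x y ^ (-α)) A ≤ μH[α] A := by
  simp only [capacity, ENNReal.inv_iInf]
  refine iSup_le fun ν => iSup_le fun _ => iSup_le fun hν => ?_
  rcases eq_or_ne (∫⁻ x in A, ∫⁻ y in A, edist x y ^ (-α) ∂ν ∂ν) ∞ with hE | hE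
  · simp [hE]
  rw [Measure.hausdorffMeasure_apply]
  refine le_iSup₂_of_le 1 one_pos (le_iInf fun t => le_iInf fun hcov => le_iInf fun hd => ?_)
  have hnonempty : ∀ n, ⨆ _ : (t n).Nonempty, Metric.ediam (t n) ^ α = Metric.ediam (t n) ^ α := by
    intro n
    rcases (t n).eq_empty_or_nonempty with h | h
    · simp [h, hα]
    · simp [h]
  rw [tsum_congr hnonempty]
  have h := measure_sq_le_lintegral_edist_rpow_neg_mul_tsum ν hα hA hE hcov
    fun n => ((hd n).trans_lt one_lt_top).ne
  rw [hν, one_pow] at h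
  exact ENNReal.inv_le_iff_le_mul (fun _ h0 => by simp [h0] at h) (fun h0 => absurd h0 hE) |>.2 h
end

section
/- Let X be a metric space (or more generally a measurable space), K : X × X → [0,∞] a measurable kernel, and (Aᵢ)_{i ∈ ℕ} a countable family of Borel subsets of X. Then the capacity is countably subadditive: Cap_K(⋃ᵢ Aᵢ) ≤ Σᵢ Cap_K(Aᵢ). -/
open MeasureTheory ENNReal

/-- Restricting a probability measure charging `B ⊆ A` to `B` and normalizing it gives a
competitor for the capacity of `A`. -/
theorem inv_capacity_mul_sq_le {X : Type*} [MeasurableSpace X] (K : X → X → ℝ≥0∞)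
    {A B : Set X} (hB : MeasurableSet B) (hBA : B ⊆ A) (ν : Measure X) [IsFiniteMeasure ν]
    (hν : ν B ≠ 0) :
    (capacity K A)⁻¹ * ν B ^ 2 ≤ ∫⁻ x in B, ∫⁻ y in B, K x y ∂ν ∂ν := by
  have hprob := ProbabilityTheory.cond_isProbabilityMeasure hν
  have hcond : ProbabilityTheory.cond ν B A = 1 := by
    refine le_antisymm prob_le_one ?_
    rw [← ProbabilityTheory.cond_apply_self hν (measure_ne_top ν B)]
    exact measure_mono hBA
  have hres : (ProbabilityTheory.cond ν B).restrict A = (ν B)⁻¹ • ν.restrict B := by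
    rw [ProbabilityTheory.cond, Measure.restrict_smul, Measure.restrict_restrict' hB,
      Set.inter_eq_right.2 hBA]
  have hle : (capacity K A)⁻¹ ≤
      (ν B)⁻¹ * ((ν B)⁻¹ * ∫⁻ x in B, ∫⁻ y in B, K x y ∂ν ∂ν) := by
    rw [capacity, inv_inv]
    refine (iInf_le_of_le (ProbabilityTheory.cond ν B) <| iInf₂_le hprob hcond).trans_eq ?_
    simp only [hres, lintegral_smul_measure, smul_eq_mul]
    rw [lintegral_const_mul' _ _ (ENNReal.inv_ne_top.2 hν)]
  calc (capacity K A)⁻¹ * ν B ^ 2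
      ≤ (ν B)⁻¹ * ((ν B)⁻¹ * ∫⁻ x in B, ∫⁻ y in B, K x y ∂ν ∂ν) * ν B ^ 2 := by gcongr
    _ = ((ν B)⁻¹ * ν B) * ((ν B)⁻¹ * ν B) * ∫⁻ x in B, ∫⁻ y in B, K x y ∂ν ∂ν := by ring
    _ = _ := by rw [ENNReal.inv_mul_cancel hν (measure_ne_top ν B), one_mul, one_mul]

/-- The mass of `B ⊆ A` is controlled by the energy on `B` and the capacity of `A`. -/
theorem measure_sq_le_energy_mul_capacity {X : Type*} [MeasurableSpace X] (K : X → X → ℝ≥0∞)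
    {A B : Set X} (hB : MeasurableSet B) (hBA : B ⊆ A) (ν : Measure X) [IsFiniteMeasure ν]
    (hE : ∫⁻ x in B, ∫⁻ y in B, K x y ∂ν ∂ν ≠ ∞) (hC : capacity K A ≠ ∞) :
    ν B ^ 2 ≤ (∫⁻ x in B, ∫⁻ y in B, K x y ∂ν ∂ν) * capacity K A := by
  by_cases hν : ν B = 0
  · simp [hν]
  have h := inv_capacity_mul_sq_le K hB hBA ν hν
  have hC0 : capacity K A ≠ 0 := by
    intro h0
    rw [h0, ENNReal.inv_zero, ENNReal.top_mul (pow_ne_zero 2 hν)] at h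
    exact hE (top_le_iff.1 h)
  calc ν B ^ 2 = (capacity K A)⁻¹ * ν B ^ 2 * capacity K A := by
        rw [mul_right_comm, ENNReal.inv_mul_cancel hC0 hC, one_mul]
    _ ≤ _ := by gcongr

/-- The energy on a disjoint union dominates the sum of the energies on the pieces. -/
theorem tsum_energy_le_energy_iUnion {X : Type*} [MeasurableSpace X] (K : X → X → ℝ≥0∞)
    {B : ℕ → Set X} (hB : ∀ i, MeasurableSet (B i)) (hd : Pairwise (Function.onFun Disjoint B))
    (ν : Measure X) :
    ∑' i, ∫⁻ x in B i, ∫⁻ y in B i, K x y ∂ν ∂ν ≤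
      ∫⁻ x in ⋃ i, B i, ∫⁻ y in ⋃ i, B i, K x y ∂ν ∂ν := by
  rw [lintegral_iUnion hB hd]
  exact ENNReal.tsum_le_tsum fun i => lintegral_mono fun x =>
    lintegral_mono_set (Set.subset_iUnion B i)

/-- Cauchy–Schwarz for series, in the form: if `p i ^ 2 ≤ a i * b i` then
`(∑ p i) ^ 2 ≤ (∑ a i) * (∑ b i)`. -/
theorem ENNReal.tsum_sq_le_tsum_mul_tsum {ι : Type*} {p a b : ι → ℝ≥0∞}
    (h : ∀ i, p i ^ 2 ≤ a i * b i) : (∑' i, p i) ^ 2 ≤ (∑' i, a i) * ∑' i, b i := by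
  have hroot (t : ℝ≥0∞) : (t ^ (1 / 2 : ℝ)) ^ (2 : ℝ) = t := by
    rw [← ENNReal.rpow_mul]; norm_num
  have hp (i : ι) : p i ≤ a i ^ (1 / 2 : ℝ) * b i ^ (1 / 2 : ℝ) := by
    rw [← ENNReal.mul_rpow_of_nonneg _ _ (by norm_num), one_div,
      ENNReal.le_rpow_inv_iff (by norm_num)]
    exact_mod_cast h i
  have hs : ∑' i, p i ≤ (∑' i, a i) ^ (1 / 2 : ℝ) * (∑' i, b i) ^ (1 / 2 : ℝ) := by
    rw [ENNReal.tsum_eq_iSup_sum]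
    refine iSup_le fun s => (Finset.sum_le_sum fun i _ => hp i).trans ?_
    refine (ENNReal.inner_le_Lp_mul_Lq s _ _ Real.HolderConjugate.two_two).trans ?_
    simp only [hroot]
    gcongr <;> exact ENNReal.sum_le_tsum s
  rw [← ENNReal.mul_rpow_of_nonneg _ _ (by norm_num), one_div,
    ENNReal.le_rpow_inv_iff (by norm_num)] at hs
  exact_mod_cast hs

/-- Countable subadditivity of capacity: for a measurable kernel `K` and a
countable family of measurable sets `Aᵢ`, `Cap_K(⋃ᵢ Aᵢ) ≤ Σᵢ Cap_K(Aᵢ)`. -/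
theorem capacity_countably_subadditive
    {X : Type*} [MeasurableSpace X] (K : X → X → ℝ≥0∞)
    (hK : Measurable fun p : X × X => K p.1 p.2)
    (A : ℕ → Set X) (hA : ∀ i, MeasurableSet (A i)) :
    capacity K (⋃ i, A i) ≤ ∑' i, capacity K (A i) := by
  by_cases hC : ∑' i, capacity K (A i) = ∞
  · simp [hC]
  rw [capacity]
  simp only [ENNReal.inv_iInf]
  refine iSup_le fun ν => iSup₂_le fun hν hνA => ?_
  have hBm (i : ℕ) : MeasurableSet (disjointed A i) := .disjointed hA i
  have hsum : ∑' i, ν (disjointed A i) = 1 := by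
    rw [← measure_iUnion (disjoint_disjointed A) hBm, iUnion_disjointed, hνA]
  have hle := tsum_energy_le_energy_iUnion K hBm (disjoint_disjointed A) ν
  rw [iUnion_disjointed] at hle
  by_cases hE : ∫⁻ x in ⋃ i, A i, ∫⁻ y in ⋃ i, A i, K x y ∂ν ∂ν = ∞
  · simp [hE]
  have hE' := ne_top_of_le_ne_top hE hle
  have key := ENNReal.tsum_sq_le_tsum_mul_tsum fun i =>
    measure_sq_le_energy_mul_capacity K (hBm i) (disjointed_le A i) ν
      (ENNReal.ne_top_of_tsum_ne_top hE' i) (ENNReal.ne_top_of_tsum_ne_top hC i)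
  rw [hsum, one_pow] at key
  rw [ENNReal.inv_le_iff_le_mul (fun h => absurd h hC) (fun h => absurd h hE)]
  exact key.trans (by gcongr)
end
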